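/- Let P be a finite poset that is disconnected (not a component). If iir(P) = |P|, then at most one connected component of P is non-trivial (has more than one element). -/

import Mathlib

open scoped Classical

/-- `S` is an inclusion representation of the poset `α`. -/
def IsRepr {α β : Type} [PartialOrder α] (S : α → Finset β) : Prop :=
  ∀ x y : α, x ≤ y ↔ S x ⊆ S y

/-- The ground set of a representation. -/
noncomputable def ground {α β : Type} [Fintype α] (S : α → Finset β) : Finset β :=
  Finset.univ.biUnion S

/-- `S` is a reduction of `T`. -/
def IsReduction {α β γ : Type} [Fintype α] (S : α → Finset β) (T : α → Finset γ) : Prop :=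
  (ground S).card ≤ (ground T).card ∧ ∀ x, (S x).card ≤ (T x).card

/-- An inclusion representation is irreducible if it admits no strict reduction. -/
def IrreducibleRepr {α β : Type} [PartialOrder α] [Fintype α] (S : α → Finset β) : Prop :=
  IsRepr S ∧ ∀ T : α → Finset ℕ, IsRepr T → IsReduction T S → IsReduction S T

/-- Maximum ground-set size over irreducible inclusion representations. -/
noncomputable def iir (α : Type) [PartialOrder α] [Fintype α] : ℕ :=
  sSup {w | ∃ S : α → Finset ℕ, IrreducibleRepr S ∧ (ground S).card = w}

/-- Cube height. -/
noncomputable def chHeight (α : Type) [PartialOrder α] [Fintype α] : ℕ :=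
  sInf {h | ∃ S : α → Finset ℕ, IsRepr S ∧ ∀ x, (S x).card ≤ h}

/-- 2-dimension. -/
noncomputable def dim2 (α : Type) [PartialOrder α] [Fintype α] : ℕ :=
  sInf {w | ∃ S : α → Finset ℕ, IsRepr S ∧ (ground S).card = w}

/-- Cube width. -/
noncomputable def cw (α : Type) [PartialOrder α] [Fintype α] : ℕ :=
  sInf {w | ∃ S : α → Finset ℕ, IsRepr S ∧ (ground S).card = w ∧ ∀ x, (S x).card ≤ chHeight α}

/-- Closed down-set `D_P[x]` as a finset. -/
noncomputable def downSet {α : Type} [PartialOrder α] [Fintype α] (x : α) : Finset α :=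
  Finset.univ.filter (· ≤ x)

/-- The canonical inclusion representation. -/
noncomputable def canonical (α : Type) [PartialOrder α] [Fintype α] : α → Finset α :=
  fun x => downSet x

/-- No Block is a Chain Property. -/
def NoBlockChain (α : Type) [PartialOrder α] : Prop :=
  ∀ x : α, ∃ y : α, ¬ x ≤ y ∧ ¬ y ≤ x

/-- Two Down Property. -/
def TwoDown (α : Type) [PartialOrder α] : Prop :=
  ∀ y : α, (∃ a b : α, a ≠ b ∧ a ⋖ y ∧ b ⋖ y) →
    ∃ z : α, (∀ u : α, u < y → u < z) ∧ ¬ y ≤ z ∧ ¬ z ≤ y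

/-- Parallel Pair Property. -/
def ParallelPair (α : Type) [PartialOrder α] : Prop :=
  ∀ x y : α, ¬ x ≤ y → ¬ y ≤ x →
    (∃ y' : α, (∀ u : α, u < x → u < y') ∧ y ≤ y' ∧ ¬ x ≤ y' ∧ ¬ y' ≤ x) ∨
    (∃ x' : α, (∀ u : α, u < y → u < x') ∧ x ≤ x' ∧ ¬ y ≤ x' ∧ ¬ x' ≤ y)

/-- A vertical decomposition of a poset into two non-empty parts. -/
def IsVerticalDecomp {α : Type} [PartialOrder α] (A B : Set α) : Prop :=
  A.Nonempty ∧ B.Nonempty ∧ (∀ x, x ∈ A ∨ x ∈ B) ∧ ∀ x ∈ A, ∀ y ∈ B, x < y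

/-- A block is a chain or a vertical prime. -/
def IsBlock (α : Type) [PartialOrder α] : Prop :=
  (∀ x y : α, x ≤ y ∨ y ≤ x) ∨ ¬ ∃ A B : Set α, IsVerticalDecomp A B

theorem mem_ground {α β : Type} [Fintype α] {S : α → Finset β} {w : β} :
    w ∈ ground S ↔ ∃ x, w ∈ S x := by
  simp [ground]

theorem IrreducibleRepr.card_ground_le {α β : Type} [PartialOrder α] [Fintype α] [Countable β]
    {S : α → Finset ℕ} (hS : IrreducibleRepr S) {T : α → Finset β} (hT : IsRepr T)
    (h : IsReduction T S) : (ground S).card ≤ (ground T).card := by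
  obtain ⟨e, he⟩ := exists_injective_nat β
  have hg : ground (fun x => (T x).map ⟨e, he⟩) = (ground T).map ⟨e, he⟩ := by
    ext w
    simp only [mem_ground, Finset.mem_map]
    exact ⟨fun ⟨x, v, hv, hw⟩ => ⟨v, ⟨x, hv⟩, hw⟩, fun ⟨v, ⟨x, hv⟩, hw⟩ => ⟨x, v, hv, hw⟩⟩
  have key := hS.2 (fun x => (T x).map ⟨e, he⟩)
    (fun x y => (hT x y).trans Finset.map_subset_map.symm)
    ⟨by rw [hg, Finset.card_map]; exact h.1, fun x => by rw [Finset.card_map]; exact h.2 x⟩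
  simpa only [hg, Finset.card_map] using key.1

theorem mem_downSet {α : Type} [PartialOrder α] [Fintype α] {x y : α} :
    x ∈ downSet y ↔ x ≤ y := by
  simp [downSet]

/-- The representation which agrees with `S` on the points used by `A` and with the canonical
representation on the complement of `A`. -/
noncomputable def hybrid {α : Type} [PartialOrder α] [Fintype α] (S : α → Finset ℕ)
    (A : Finset α) (x : α) : Finset (ℕ ⊕ α) :=
  (S x ∩ A.biUnion S).disjSum (downSet x \ A)

theorem isRepr_hybrid {α : Type} [PartialOrder α] [Fintype α] {S : α → Finset ℕ}
    (hS : IsRepr S) (A : Finset α) : IsRepr (hybrid S A) := by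
  intro x y
  constructor
  · intro hxy
    refine Finset.disjSum_mono (Finset.inter_subset_inter_right ((hS x y).1 hxy)) ?_
    refine Finset.sdiff_subset_sdiff (fun z hz => ?_) subset_rfl
    exact mem_downSet.2 ((mem_downSet.1 hz).trans hxy)
  · intro h
    by_cases hx : x ∈ A
    · refine (hS x y).2 fun w hw => ?_
      have hw' : Sum.inl w ∈ hybrid S A x :=
        Finset.inl_mem_disjSum.2
          (Finset.mem_inter.2 ⟨hw, Finset.mem_biUnion.2 ⟨x, hx, hw⟩⟩)
      exact (Finset.mem_inter.1 (Finset.inl_mem_disjSum.1 (h hw'))).1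
    · have hx' : Sum.inr x ∈ hybrid S A x :=
        Finset.inr_mem_disjSum.2 (Finset.mem_sdiff.2 ⟨mem_downSet.2 le_rfl, hx⟩)
      exact mem_downSet.1 (Finset.mem_sdiff.1 (Finset.inr_mem_disjSum.1 (h hx'))).1

theorem card_ground_hybrid_le {α : Type} [PartialOrder α] [Fintype α] (S : α → Finset ℕ)
    (A : Finset α) : (ground (hybrid S A)).card ≤ (A.biUnion S).card + Aᶜ.card := by
  rw [← Finset.card_disjSum]
  refine Finset.card_le_card fun w hw => ?_
  obtain ⟨x, hx⟩ := mem_ground.1 hw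
  refine Finset.disjSum_mono Finset.inter_subset_right (fun z hz => ?_) hx
  exact Finset.mem_compl.2 (Finset.mem_sdiff.1 hz).2

/-- If `A` has maximal Hall deficiency, the hybrid representation does not increase sizes. -/
theorem card_hybrid_le {α : Type} [PartialOrder α] [Fintype α] {S : α → Finset ℕ}
    (hS : IsRepr S) {A : Finset α}
    (hA : ∀ B : Finset α, (A.biUnion S).card + Aᶜ.card ≤ (B.biUnion S).card + Bᶜ.card) (x : α) :
    (hybrid S A x).card ≤ (S x).card := by
  have hall : ∀ s : Finset {z // z ∉ A},
      s.card ≤ (s.biUnion fun z => S z.1 \ A.biUnion S).card := by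
    intro s
    let B : Finset α := s.map (Function.Embedding.subtype _)
    have hdisj : Disjoint A B := by
      rw [Finset.disjoint_right]
      intro z hz
      obtain ⟨u, -, rfl⟩ := Finset.mem_map.1 hz
      exact u.2
    have hunion : (A ∪ B).biUnion S =
        A.biUnion S ∪ s.biUnion fun z => S z.1 \ A.biUnion S := by
      ext w
      simp only [B, Finset.mem_biUnion, Finset.mem_union, Finset.mem_map, Finset.mem_sdiff]
      constructor
      · rintro ⟨z, hz | ⟨u, hu, rfl⟩, hw⟩
        · exact Or.inl ⟨z, hz, hw⟩
        · by_cases h : ∃ a ∈ A, w ∈ S a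
          · exact Or.inl h
          · exact Or.inr ⟨u, hu, hw, h⟩
      · rintro (⟨z, hz, hw⟩ | ⟨u, hu, hw, -⟩)
        · exact ⟨z, Or.inl hz, hw⟩
        · exact ⟨u, Or.inr ⟨u, hu, rfl⟩, hw⟩
    have h1 := hA (A ∪ B)
    have h2 := Finset.card_union_le (A.biUnion S) (s.biUnion fun z => S z.1 \ A.biUnion S)
    rw [← hunion] at h2
    have h3 := Finset.card_union_of_disjoint hdisj
    have h4 : B.card = s.card := Finset.card_map _
    have h5 := Finset.card_add_card_compl A
    have h6 := Finset.card_add_card_compl (A ∪ B)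
    omega
  obtain ⟨f, hf, hmem⟩ :=
    (Finset.all_card_le_biUnion_card_iff_exists_injective
      fun z : {z // z ∉ A} => S z.1 \ A.biUnion S).1 hall
  have hle : (downSet x \ A).card ≤ (S x \ A.biUnion S).card := by
    have hsub : ((downSet x \ A).subtype (· ∉ A)).image f ⊆ S x \ A.biUnion S := by
      intro w hw
      obtain ⟨z, hz, rfl⟩ := Finset.mem_image.1 hw
      have hzx := mem_downSet.1 (Finset.mem_sdiff.1 (Finset.mem_subtype.1 hz)).1
      have := Finset.mem_sdiff.1 (hmem z)
      exact Finset.mem_sdiff.2 ⟨(hS _ _).1 hzx this.1, this.2⟩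
    have h := Finset.card_le_card hsub
    rwa [Finset.card_image_of_injective _ hf, Finset.card_subtype,
      Finset.filter_true_of_mem fun z hz => (Finset.mem_sdiff.1 hz).2] at h
  rw [hybrid, Finset.card_disjSum]
  have := Finset.card_inter_add_card_sdiff (S x) (A.biUnion S)
  omega

/-- An irreducible representation with ground set as large as the poset has sets at least as
large as those of the canonical representation. -/
theorem IrreducibleRepr.card_downSet_le {α : Type} [PartialOrder α] [Fintype α]
    {S : α → Finset ℕ} (hS : IrreducibleRepr S) (hcard : (ground S).card = Fintype.card α)
    (x : α) : (downSet x).card ≤ (S x).card := by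
  obtain ⟨A, -, hA⟩ := Finset.exists_min_image (Finset.univ : Finset (Finset α))
    (fun A => (A.biUnion S).card + Aᶜ.card) Finset.univ_nonempty
  have hA' := fun B => hA B (Finset.mem_univ B)
  have hempty : ((∅ : Finset α).biUnion S).card + (∅ : Finset α)ᶜ.card = Fintype.card α := by
    simp
  have hground := card_ground_hybrid_le S A
  have hle := hA' ∅
  have hge := hS.card_ground_le (isRepr_hybrid hS.1 A)
    ⟨by omega, card_hybrid_le hS.1 hA'⟩
  have hmin : ∀ B : Finset α, ((∅ : Finset α).biUnion S).card + (∅ : Finset α)ᶜ.card ≤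
      (B.biUnion S).card + Bᶜ.card := fun B => by
    have := hA' B
    omega
  simpa [hybrid] using card_hybrid_le hS.1 hmin x

/-- Identifying the top elements of two strict pairs with no common upper bounds in the canonical
representation again gives a representation. -/
theorem isRepr_image_downSet {α : Type} [PartialOrder α] [Fintype α] {a b c d : α}
    (hab : a < b) (hcd : c < d) (had : ∀ y, a ≤ y → ¬ d ≤ y) (hcb : ∀ y, c ≤ y → ¬ b ≤ y) :
    IsRepr fun x => (downSet x).image fun z => if z = d then b else z := by
  have had' : a ≠ d := fun h => had a le_rfl h.ge
  have hcb' : c ≠ b := fun h => hcb c le_rfl h.ge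
  intro x y
  constructor
  · intro hxy
    refine Finset.image_subset_image fun z hz => ?_
    exact mem_downSet.2 ((mem_downSet.1 hz).trans hxy)
  · intro h
    have key : ∀ z ≤ x, ∃ u ≤ y, (if u = d then b else u) = if z = d then b else z := by
      intro z hz
      obtain ⟨u, hu, he⟩ := Finset.mem_image.1
        (h (Finset.mem_image_of_mem (fun z => if z = d then b else z) (mem_downSet.2 hz)))
      exact ⟨u, mem_downSet.1 hu, he⟩
    have keep : ∀ z ≤ x, z ≠ b → z ≠ d → z ≤ y := by
      intro z hz hzb hzd
      obtain ⟨u, hu, he⟩ := key z hz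
      rw [if_neg hzd] at he
      split_ifs at he
      · exact absurd he.symm hzb
      · exact he ▸ hu
    obtain ⟨u, hu, he⟩ := key x le_rfl
    by_cases hxd : x = d
    · subst hxd
      have hc := keep c hcd.le hcb' hcd.ne
      rw [if_pos rfl] at he
      split_ifs at he with hud
      · exact hud ▸ hu
      · exact absurd (he ▸ hu) (hcb y hc)
    · by_cases hxb : x = b
      · subst hxb
        have ha := keep a hab.le hab.ne had'
        rw [if_neg hxd] at he
        split_ifs at he with hud
        · exact absurd (hud ▸ hu) (had y ha)
        · exact he ▸ hu
      · exact keep x le_rfl hxb hxd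

theorem exists_lt_of_reflTransGen {α : Type} [PartialOrder α] {x x' : α} (hne : x' ≠ x)
    (h : Relation.ReflTransGen (fun a b : α => a ≤ b ∨ b ≤ a) x x') :
    ∃ a b, a < b ∧ Relation.ReflTransGen (fun a b : α => a ≤ b ∨ b ≤ a) x a := by
  induction h with
  | refl => exact absurd rfl hne
  | @tail z w hz hzw ih =>
    by_cases hzx : z = x
    · subst hzx
      rcases hzw with hzw | hzw
      · exact ⟨z, w, lt_of_le_of_ne hzw hne.symm, hz⟩
      · exact ⟨w, z, lt_of_le_of_ne hzw hne, hz.tail (Or.inr hzw)⟩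
    · exact ih hzx

theorem exists_irreducibleRepr_of_iir_pos {α : Type} [PartialOrder α] [Fintype α]
    (h : 0 < iir α) : ∃ S : α → Finset ℕ, IrreducibleRepr S ∧ (ground S).card = iir α := by
  have hne : {w | ∃ S : α → Finset ℕ, IrreducibleRepr S ∧ (ground S).card = w}.Nonempty := by
    rw [Set.nonempty_iff_ne_empty]
    intro he
    rw [iir, he, csSup_empty] at h
    exact lt_irrefl _ h
  refine Nat.sSup_mem hne (not_not.1 fun hb => ?_)
  rw [iir, Nat.sSup_of_not_bddAbove hb] at h
  exact lt_irrefl _ h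

/-- if `P` is disconnected and `iir P = |P|`, then at most one connected
component of `P` is non-trivial (any two elements of non-trivial components are
connected to each other by the comparability relation). -/
theorem disconnected_iir_one_nontrivial_component (α : Type) [PartialOrder α] [Fintype α]
    (hdisc : ∃ A B : Set α, A.Nonempty ∧ B.Nonempty ∧ (∀ x, x ∈ A ∨ x ∈ B) ∧
      ∀ x ∈ A, ∀ y ∈ B, ¬ x ≤ y ∧ ¬ y ≤ x)
    (hiir : iir α = Fintype.card α) :
    ∀ x y : α,
      (∃ x', x' ≠ x ∧ Relation.ReflTransGen (fun a b : α => a ≤ b ∨ b ≤ a) x x') →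
      (∃ y', y' ≠ y ∧ Relation.ReflTransGen (fun a b : α => a ≤ b ∨ b ≤ a) y y') →
      Relation.ReflTransGen (fun a b : α => a ≤ b ∨ b ≤ a) x y := by
  rintro x y ⟨x', hx', hxx'⟩ ⟨y', hy', hyy'⟩
  by_contra hxy
  obtain ⟨a, b, hab, hxa⟩ := exists_lt_of_reflTransGen hx' hxx'
  obtain ⟨c, d, hcd, hyc⟩ := exists_lt_of_reflTransGen hy' hyy'
  have hsymm : Std.Symm fun a b : α => a ≤ b ∨ b ≤ a := ⟨fun _ _ => Or.symm⟩
  have hcy : Relation.ReflTransGen (fun a b : α => a ≤ b ∨ b ≤ a) c y :=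
    Relation.ReflTransGen.stdSymm.symm _ _ hyc
  have had : ∀ z, a ≤ z → ¬ d ≤ z := fun z haz hdz =>
    hxy (((hxa.tail (Or.inl haz)).tail (Or.inr (hcd.le.trans hdz))).trans hcy)
  have hcb : ∀ z, c ≤ z → ¬ b ≤ z := fun z hcz hbz =>
    hxy (((hxa.tail (Or.inl (hab.le.trans hbz))).tail (Or.inr hcz)).trans hcy)
  have hpos : 0 < Fintype.card α := Fintype.card_pos_iff.2 ⟨x⟩
  obtain ⟨S, hS, hcard⟩ := exists_irreducibleRepr_of_iir_pos (hiir ▸ hpos)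
  rw [hiir] at hcard
  have hbd : b ≠ d := fun h => had b hab.le h.ge
  have hlt : (ground fun x => (downSet x).image fun z => if z = d then b else z).card <
      Fintype.card α := by
    rw [← Finset.card_univ]
    refine Finset.card_lt_card (Finset.ssubset_univ_iff.2 fun h => ?_)
    obtain ⟨x, hx⟩ := mem_ground.1 (h ▸ Finset.mem_univ d)
    obtain ⟨z, -, hz⟩ := Finset.mem_image.1 hx
    split_ifs at hz with hzd
    · exact hbd hz
    · exact hzd hz
  have hge := hS.card_ground_le (isRepr_image_downSet hab hcd had hcb)
    ⟨by omega, fun x => Finset.card_image_le.trans (hS.card_downSet_le hcard x)⟩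
  omega
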